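/- Let X be an irreducible, aperiodic, stationary first-order Markov chain on the finite alphabet 𝒳, g: 𝒳 → 𝒴, and Y_n := g(X_n). Then for every k ≥ 1, Δ_P^k(X, g) ≥ Δ_L^k(X, g) ≥ D̄(Y‖Y^(k)), where Y^(k) is the stationary k-th order Markov chain on 𝒴 with transition matrix Q_{i_1,...,i_k→j} = p_{Y_{k+1}|Y_1^k}(j | i_1,...,i_k). -/

import Mathlib

open Filter

section MarkovAggregation

variable {𝒳 : Type*} {𝒴 : Type*} [Fintype 𝒳] [DecidableEq 𝒳] [Fintype 𝒴] [DecidableEq 𝒴]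

/-- Shannon entropy of a probability mass function on a finite set. -/
noncomputable def entPMF {α : Type*} [Fintype α] (p : α → ℝ) : ℝ :=
  ∑ a : α, Real.negMulLog (p a)

/-- Marginal of a joint pmf on the first component. -/
noncomputable def margFst {α β : Type*} [Fintype β] (p : α × β → ℝ) : α → ℝ :=
  fun a => ∑ b : β, p (a, b)

/-- Marginal of a joint pmf on the second component. -/
noncomputable def margSnd {α β : Type*} [Fintype α] (p : α × β → ℝ) : β → ℝ :=
  fun b => ∑ a : α, p (a, b)

/-- Conditional Shannon entropy H(A | B) of a joint pmf `p` of the pair (A, B). -/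
noncomputable def condEntPMF {α β : Type*} [Fintype α] [Fintype β] (p : α × β → ℝ) : ℝ :=
  entPMF p - entPMF (margSnd p)

/-- Mutual information I(A ; B) of a joint pmf `p` of the pair (A, B). -/
noncomputable def mutInfPMF {α β : Type*} [Fintype α] [Fintype β] (p : α × β → ℝ) : ℝ :=
  entPMF (margFst p) + entPMF (margSnd p) - entPMF p

/-- Probability that a first-order Markov chain with initial distribution `π` and transition
matrix `P` emits the path (x_0, ..., x_{n-1}). -/
noncomputable def xPath (π : 𝒳 → ℝ) (P : Matrix 𝒳 𝒳 ℝ) (n : ℕ) (x : Fin n → 𝒳) : ℝ :=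
  (if h : 0 < n then π (x ⟨0, h⟩) else 1) *
    ∏ i : Fin n, if h : i.val + 1 < n then P (x i) (x ⟨i.val + 1, h⟩) else 1

/-- Probability that the projection Y_n = g(X_n) emits the path (y_0, ..., y_{n-1}). -/
noncomputable def yPath (π : 𝒳 → ℝ) (P : Matrix 𝒳 𝒳 ℝ) (g : 𝒳 → 𝒴) (n : ℕ)
    (y : Fin n → 𝒴) : ℝ :=
  ∑ x : Fin n → 𝒳, if ∀ i, g (x i) = y i then xPath π P n x else 0

/-- Joint probability of (X_1, (Y_2, ..., Y_{m+1})). -/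
noncomputable def xyPath (π : 𝒳 → ℝ) (P : Matrix 𝒳 𝒳 ℝ) (g : 𝒳 → 𝒴) (m : ℕ)
    (x₀ : 𝒳) (y : Fin m → 𝒴) : ℝ :=
  ∑ x : Fin (m + 1) → 𝒳,
    if x 0 = x₀ ∧ ∀ i : Fin m, g (x i.succ) = y i then xPath π P (m + 1) x else 0

/-- A matrix is primitive iff some power (and all larger powers) of it is entrywise positive;
for a stochastic matrix this is equivalent to being irreducible and aperiodic. -/
def PrimitiveMatrix (P : Matrix 𝒳 𝒳 ℝ) : Prop :=
  ∃ N : ℕ, ∀ n : ℕ, N ≤ n → ∀ i j : 𝒳, 0 < (P ^ n) i j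

/-- A Markov chain with transition matrix `P` is `k`-lumpable w.r.t. `g` iff for every initial
distribution `π` the projected process is a `k`-th order Markov chain whose transition matrix `Q`
does not depend on `π`. -/
def Lumpable (P : Matrix 𝒳 𝒳 ℝ) (g : 𝒳 → 𝒴) (k : ℕ) : Prop :=
  ∃ Q : (Fin k → 𝒴) → 𝒴 → ℝ,
    ∀ π : 𝒳 → ℝ, (∀ x, 0 ≤ π x) → (∑ x, π x = 1) →
      ∀ n : ℕ, ∀ hn : k ≤ n, ∀ y : Fin n → 𝒴, ∀ j : 𝒴,
        yPath π P g (n + 1) (Fin.snoc y j) =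
          yPath π P g n y *
            Q (fun i : Fin k => y ⟨n - k + i.val, by have := i.isLt; omega⟩) j

/-- The lumpability cost Δ_L^{k+1}(X, g) = H(Y_{k+2} | Y_1^{k+1}) - H(Y_{k+2} | Y_2^{k+1}, X_1),
for the stationary chain with invariant distribution `μ` and transition matrix `P`. -/
noncomputable def lumpCost (μ : 𝒳 → ℝ) (P : Matrix 𝒳 𝒳 ℝ) (g : 𝒳 → 𝒴) (k : ℕ) : ℝ :=
  condEntPMF (fun q : 𝒴 × (Fin (k + 1) → 𝒴) => yPath μ P g (k + 2) (Fin.snoc q.2 q.1)) -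
  condEntPMF (fun q : 𝒴 × (𝒳 × (Fin k → 𝒴)) =>
    xyPath μ P g (k + 1) q.2.1 (Fin.snoc q.2.2 q.1))

/-- The predictability cost Δ_P^{k+1}(X, g) = I(X_2 ; X_1) - I(Y_{k+2} ; Y_1^{k+1}),
for the stationary chain with invariant distribution `μ` and transition matrix `P`. -/
noncomputable def predCost (μ : 𝒳 → ℝ) (P : Matrix 𝒳 𝒳 ℝ) (g : 𝒳 → 𝒴) (k : ℕ) : ℝ :=
  mutInfPMF (fun q : 𝒳 × 𝒳 => μ q.1 * P q.1 q.2) -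
  mutInfPMF (fun q : 𝒴 × (Fin (k + 1) → 𝒴) => yPath μ P g (k + 2) (Fin.snoc q.2 q.1))

/-- Path probabilities of a stationary `K`-th order Markov chain on `𝒴` with stationary
`K`-dimensional distribution `ρ` and transition matrix `R`. -/
noncomputable def mkvPath {K : ℕ} (ρ : (Fin K → 𝒴) → ℝ) (R : (Fin K → 𝒴) → 𝒴 → ℝ)
    (n : ℕ) (y : Fin n → 𝒴) : ℝ :=
  if h : K ≤ n then
    ρ (fun i => y ⟨i.val, lt_of_lt_of_le i.isLt h⟩) *
      ∏ m : Fin n, if hm : K ≤ m.val then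
        R (fun i => y ⟨m.val - K + i.val, by have h1 := i.isLt; have h2 := m.isLt; omega⟩) (y m)
      else 1
  else
    ∑ z : Fin K → 𝒴, if ∀ i : Fin n, z ⟨i.val, by have := i.isLt; omega⟩ = y i then ρ z else 0

end MarkovAggregation

section Helpers

set_option linter.unusedSectionVars false

/-- Homogeneous conditional-entropy functional. -/
noncomputable def Gf {α : Type*} [Fintype α] (f : α → ℝ) : ℝ :=
  ∑ a, Real.negMulLog (f a) - Real.negMulLog (∑ a, f a)

theorem Gf_smul {α : Type*} [Fintype α] (w : ℝ) (f : α → ℝ) :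
    Gf (fun a => w * f a) = w * Gf f := by
  unfold Gf
  rw [← Finset.mul_sum]
  simp only [Real.negMulLog_mul, Finset.sum_add_distrib, ← Finset.mul_sum, ← Finset.sum_mul]
  ring

theorem Gf_term {f F S T : ℝ} (hf : 0 ≤ f) (hF : f ≤ F) (hS : f ≤ S) (hT : S ≤ T) :
    f * (Real.log F - Real.log f) ≤ f * (Real.log T - Real.log S) + (F * S / T - f) := by
  rcases hf.eq_or_lt with h | h
  · subst h
    have : 0 ≤ F * S / T := div_nonneg (mul_nonneg hF hS) (hS.trans hT)
    simpa using this
  · have hF' : 0 < F := h.trans_le hF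
    have hS' : 0 < S := h.trans_le hS
    have hT' : 0 < T := hS'.trans_le hT
    have hl : Real.log (F * S / T / f) = Real.log F + Real.log S - Real.log T - Real.log f := by
      rw [Real.log_div (by positivity) (by positivity), Real.log_div (by positivity) (by positivity),
        Real.log_mul (by positivity) (by positivity)]
    have h1 := Real.log_le_sub_one_of_pos (show 0 < F * S / T / f by positivity)
    rw [hl] at h1
    have h2 := mul_le_mul_of_nonneg_left h1 hf
    have h3 : f * (F * S / T / f - 1) = F * S / T - f := by field_simp
    rw [h3] at h2
    linarith

theorem Gf_eq {α : Type*} [Fintype α] (f : α → ℝ) :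
    Gf f = ∑ a, f a * (Real.log (∑ b, f b) - Real.log (f a)) := by
  unfold Gf
  simp only [mul_sub, Finset.sum_sub_distrib, ← Finset.sum_mul, Real.negMulLog]
  simp only [neg_mul, Finset.sum_neg_distrib]
  ring

theorem Gf_super {ι α : Type*} [Fintype ι] [Fintype α] (f : ι → α → ℝ)
    (hf : ∀ i a, 0 ≤ f i a) :
    ∑ i, Gf (f i) ≤ Gf (fun a => ∑ i, f i a) := by
  set S : α → ℝ := fun a => ∑ i, f i a with hS
  set T : ℝ := ∑ a, S a with hT
  have hTsum : T = ∑ i, ∑ a, f i a := by rw [hT]; exact Finset.sum_comm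
  have hS0 : ∀ a, 0 ≤ S a := fun a => Finset.sum_nonneg fun i _ => hf i a
  have hT0 : 0 ≤ T := Finset.sum_nonneg fun a _ => hS0 a
  have key : ∀ i, Gf (f i) ≤ ∑ a, f i a * (Real.log T - Real.log (S a)) := by
    intro i
    rw [Gf_eq]
    have hF0 : 0 ≤ ∑ a, f i a := Finset.sum_nonneg fun a _ => hf i a
    have h1 : ∑ a, f i a * (Real.log (∑ b, f i b) - Real.log (f i a)) ≤
        ∑ a, (f i a * (Real.log T - Real.log (S a)) + ((∑ b, f i b) * S a / T - f i a)) := by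
      refine Finset.sum_le_sum fun a _ => Gf_term (hf i a) ?_ ?_ ?_
      · exact Finset.single_le_sum (f := fun b => f i b) (fun b _ => hf i b) (Finset.mem_univ a)
      · exact Finset.single_le_sum (f := fun i => f i a) (fun b _ => hf b a) (Finset.mem_univ i)
      · exact Finset.single_le_sum (f := S) (fun b _ => hS0 b) (Finset.mem_univ a)
    rw [Finset.sum_add_distrib, Finset.sum_sub_distrib, ← Finset.sum_div, ← Finset.mul_sum,
      ← hT] at h1
    have h2 : (∑ b, f i b) * T / T ≤ ∑ b, f i b := by
      rcases hT0.eq_or_lt with h | h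
      · rw [← h]; simpa using hF0
      · rw [mul_div_assoc, div_self h.ne', mul_one]
    linarith
  refine (Finset.sum_le_sum fun i _ => key i).trans ?_
  rw [Gf_eq, Finset.sum_comm]
  refine le_of_eq (Finset.sum_congr rfl fun a _ => ?_)
  rw [← Finset.sum_mul]

theorem Gf_super_w {ι α : Type*} [Fintype ι] [Fintype α] (w : ι → ℝ) (f : ι → α → ℝ)
    (hw : ∀ i, 0 ≤ w i) (hf : ∀ i a, 0 ≤ f i a) :
    ∑ i, w i * Gf (f i) ≤ Gf (fun a => ∑ i, w i * f i a) := by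
  simp only [← Gf_smul]
  exact Gf_super (fun i a => w i * f i a) fun i a => mul_nonneg (hw i) (hf i a)

theorem condEnt_eq {α β : Type*} [Fintype α] [Fintype β] (p : α × β → ℝ) :
    condEntPMF p = ∑ b, Gf (fun a => p (a, b)) := by
  unfold condEntPMF entPMF margSnd Gf
  rw [Finset.sum_sub_distrib, Fintype.sum_prod_type_right]

theorem sum_cons' {α : Type*} [Fintype α] {M : Type*} [AddCommMonoid M] (n : ℕ)
    (F : (Fin (n + 1) → α) → M) :
    ∑ y, F y = ∑ a, ∑ y : Fin n → α, F (Fin.cons a y) := by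
  rw [← Fintype.sum_prod_type']
  exact (Equiv.sum_comp (Fin.consEquiv fun _ => α) F).symm

theorem sum_snoc' {α : Type*} [Fintype α] {M : Type*} [AddCommMonoid M] (n : ℕ)
    (F : (Fin (n + 1) → α) → M) :
    ∑ y, F y = ∑ y : Fin n → α, ∑ a, F (Fin.snoc y a) := by
  rw [← Fintype.sum_prod_type_right']
  exact (Equiv.sum_comp (Fin.snocEquiv fun _ => α) F).symm

variable {𝒳 : Type*} {𝒴 : Type*} [Fintype 𝒳] [DecidableEq 𝒳] [Fintype 𝒴] [DecidableEq 𝒴]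

theorem xPath_cons (π : 𝒳 → ℝ) (P : Matrix 𝒳 𝒳 ℝ) (n : ℕ) (a : 𝒳) (x : Fin n → 𝒳) :
    xPath π P (n + 1) (Fin.cons a x) = π a * xPath (P a) P n x := by
  unfold xPath
  rw [Fin.prod_univ_succ]
  have h0 : ∀ h : 0 < n + 1, (⟨0, h⟩ : Fin (n + 1)) = 0 := fun h => rfl
  simp only [Nat.zero_lt_succ, dif_pos, h0, Fin.cons_zero, Fin.val_zero, zero_add, Fin.cons_succ,
    Fin.val_succ]
  congr 1
  congr 1
  · cases n with
    | zero => simp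
    | succ n =>
      simp only [Nat.lt_add_left_iff_pos, Nat.zero_lt_succ, dif_pos]
      rfl
  · refine Finset.prod_congr rfl fun i _ => ?_
    by_cases h : i.val + 1 < n
    · rw [dif_pos h, dif_pos (by omega)]; rfl
    · rw [dif_neg h, dif_neg (by omega)]

theorem yPath_zero (π : 𝒳 → ℝ) (P : Matrix 𝒳 𝒳 ℝ) (g : 𝒳 → 𝒴) (y : Fin 0 → 𝒴) :
    yPath π P g 0 y = 1 := by
  simp [yPath, xPath]

theorem yPath_cons (π : 𝒳 → ℝ) (P : Matrix 𝒳 𝒳 ℝ) (g : 𝒳 → 𝒴) (n : ℕ) (b : 𝒴)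
    (y : Fin n → 𝒴) :
    yPath π P g (n + 1) (Fin.cons b y) =
      ∑ a, if g a = b then π a * yPath (P a) P g n y else 0 := by
  unfold yPath
  rw [sum_cons']
  refine Finset.sum_congr rfl fun a _ => ?_
  simp only [Fin.forall_fin_succ, Fin.cons_zero, Fin.cons_succ, xPath_cons]
  by_cases h : g a = b
  · simp only [h, true_and, if_true, Finset.mul_sum, mul_ite, mul_zero]
  · simp [h]

theorem xyPath_eq (π : 𝒳 → ℝ) (P : Matrix 𝒳 𝒳 ℝ) (g : 𝒳 → 𝒴) (n : ℕ) (a : 𝒳)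
    (y : Fin n → 𝒴) :
    xyPath π P g n a y = π a * yPath (P a) P g n y := by
  unfold xyPath yPath
  rw [sum_cons']
  simp only [Fin.cons_zero, Fin.cons_succ, xPath_cons]
  rw [Finset.sum_eq_single a]
  · simp only [true_and, Finset.mul_sum, mul_ite, mul_zero]
  · intro b _ hb
    simp [hb]
  · simp

theorem yPath_nonneg (P : Matrix 𝒳 𝒳 ℝ) (hP0 : ∀ i j, 0 ≤ P i j) (g : 𝒳 → 𝒴) (n : ℕ)
    (π : 𝒳 → ℝ) (hπ : ∀ x, 0 ≤ π x) (y : Fin n → 𝒴) : 0 ≤ yPath π P g n y := by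
  unfold yPath
  refine Finset.sum_nonneg fun x _ => ?_
  split_ifs
  · unfold xPath
    refine mul_nonneg ?_ (Finset.prod_nonneg fun i _ => ?_)
    · split_ifs
      · exact hπ _
      · exact zero_le_one
    · split_ifs
      · exact hP0 _ _
      · exact zero_le_one
  · exact le_rfl

theorem sum_fib (g : 𝒳 → 𝒴) (F : 𝒳 → ℝ) :
    ∑ b, ∑ a, (if g a = b then F a else 0) = ∑ a, F a := by
  rw [Finset.sum_comm]
  simp

theorem yPath_snoc_sum (P : Matrix 𝒳 𝒳 ℝ) (hP1 : ∀ i, ∑ j : 𝒳, P i j = 1) (g : 𝒳 → 𝒴) (n : ℕ) :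
    ∀ (π : 𝒳 → ℝ) (_ : ∑ x, π x = 1) (y : Fin n → 𝒴),
    ∑ j, yPath π P g (n + 1) (Fin.snoc y j) = yPath π P g n y := by
  induction n with
  | zero =>
    intro π hπ y
    have : ∀ j : 𝒴, (Fin.snoc y j : Fin 1 → 𝒴) = Fin.cons j y := by
      intro j; ext i; fin_cases i; simp [Fin.snoc]
    simp only [this, yPath_cons, yPath_zero, mul_one]
    rw [sum_fib, hπ]
  | succ n ih =>
    intro π hπ y
    induction y using Fin.consCases with
    | _ b y =>
    simp only [← Fin.cons_snoc_eq_snoc_cons, yPath_cons]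
    rw [Finset.sum_comm]
    refine Finset.sum_congr rfl fun a _ => ?_
    split_ifs
    · rw [← Finset.mul_sum, ih _ (hP1 a)]
    · simp

theorem yPath_mix (P : Matrix 𝒳 𝒳 ℝ) (μ : 𝒳 → ℝ) (hμ1 : ∑ x : 𝒳, μ x = 1)
    (hμ2 : ∀ j, ∑ i : 𝒳, μ i * P i j = μ j) (g : 𝒳 → 𝒴) (n : ℕ) (y : Fin n → 𝒴) :
    ∑ a, μ a * yPath (P a) P g n y = yPath μ P g n y := by
  cases n with
  | zero => simp [yPath_zero, hμ1]
  | succ n =>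
    induction y using Fin.consCases with
    | _ b y =>
    simp only [yPath_cons, Finset.mul_sum]
    rw [Finset.sum_comm]
    refine Finset.sum_congr rfl fun a _ => ?_
    split_ifs
    · rw [← hμ2 a, Finset.sum_mul]
      refine Finset.sum_congr rfl fun c _ => by ring
    · simp

theorem yPath_cons_sum (P : Matrix 𝒳 𝒳 ℝ) (μ : 𝒳 → ℝ) (hμ1 : ∑ x : 𝒳, μ x = 1)
    (hμ2 : ∀ j, ∑ i : 𝒳, μ i * P i j = μ j) (g : 𝒳 → 𝒴) (n : ℕ) (y : Fin n → 𝒴) :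
    ∑ b, yPath μ P g (n + 1) (Fin.cons b y) = yPath μ P g n y := by
  simp only [yPath_cons]
  rw [sum_fib, yPath_mix P μ hμ1 hμ2]

/-- Conditional entropy of the next symbol given `n` symbols. -/
noncomputable def aSeq (π : 𝒳 → ℝ) (P : Matrix 𝒳 𝒳 ℝ) (g : 𝒳 → 𝒴) (n : ℕ) : ℝ :=
  ∑ v : Fin n → 𝒴, Gf (fun j => yPath π P g (n + 1) (Fin.snoc v j))

/-- Conditional entropy given `n` symbols and an initial state. -/
noncomputable def cSeq (μ : 𝒳 → ℝ) (P : Matrix 𝒳 𝒳 ℝ) (g : 𝒳 → 𝒴) (n : ℕ) : ℝ :=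
  ∑ x, μ x * aSeq (P x) P g n

theorem aSeq_step (P : Matrix 𝒳 𝒳 ℝ) (hP0 : ∀ i j, 0 ≤ P i j) (g : 𝒳 → 𝒴) (n : ℕ)
    (π : 𝒳 → ℝ) (hπ : ∀ x, 0 ≤ π x) :
    cSeq π P g n ≤ aSeq π P g (n + 1) := by
  unfold cSeq
  conv_rhs => unfold aSeq
  rw [sum_cons', ← sum_fib g]
  refine Finset.sum_le_sum fun b _ => ?_
  have h1 : ∀ v : Fin n → 𝒴, ∑ a, (if g a = b then π a else 0) *
        Gf (fun j => yPath (P a) P g (n + 1) (Fin.snoc v j)) ≤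
      Gf (fun j => yPath π P g (n + 1 + 1) (Fin.snoc (Fin.cons b v) j)) := by
    intro v
    refine (Gf_super_w _ _ ?_ ?_).trans (le_of_eq ?_)
    · intro i; split_ifs
      · exact hπ i
      · exact le_rfl
    · intro i j; exact yPath_nonneg P hP0 g _ _ (hP0 i) _
    · congr 1
      ext j
      rw [← Fin.cons_snoc_eq_snoc_cons, yPath_cons]
      refine Finset.sum_congr rfl fun a _ => ?_
      split_ifs <;> simp
  refine le_trans (le_of_eq ?_) (Finset.sum_le_sum fun v _ => h1 v)
  rw [Finset.sum_comm]
  refine Finset.sum_congr rfl fun a _ => ?_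
  rw [← Finset.mul_sum]
  unfold aSeq
  split_ifs <;> simp

theorem cSeq_mono (P : Matrix 𝒳 𝒳 ℝ) (hP0 : ∀ i j, 0 ≤ P i j)
    (μ : 𝒳 → ℝ) (hμ0 : ∀ x, 0 ≤ μ x)
    (hμ2 : ∀ j, ∑ i : 𝒳, μ i * P i j = μ j) (g : 𝒳 → 𝒴) :
    Monotone (cSeq μ P g) := by
  refine monotone_nat_of_le_succ fun n => ?_
  have h : ∀ x, cSeq (P x) P g n ≤ aSeq (P x) P g (n + 1) := fun x =>
    aSeq_step P hP0 g n _ (hP0 x)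
  calc cSeq μ P g n = ∑ x, μ x * cSeq (P x) P g n := by
        unfold cSeq
        simp only [Finset.mul_sum]
        rw [Finset.sum_comm]
        refine Finset.sum_congr rfl fun a _ => ?_
        rw [← hμ2 a, Finset.sum_mul]
        refine Finset.sum_congr rfl fun c _ => by ring
    _ ≤ _ := Finset.sum_le_sum fun x _ => mul_le_mul_of_nonneg_left (h x) (hμ0 x)

theorem aSeq_anti (P : Matrix 𝒳 𝒳 ℝ) (hP0 : ∀ i j, 0 ≤ P i j)
    (μ : 𝒳 → ℝ) (hμ0 : ∀ x, 0 ≤ μ x) (hμ1 : ∑ x : 𝒳, μ x = 1)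
    (hμ2 : ∀ j, ∑ i : 𝒳, μ i * P i j = μ j) (g : 𝒳 → 𝒴) :
    Antitone (aSeq μ P g) := by
  refine antitone_nat_of_succ_le fun n => ?_
  unfold aSeq
  rw [sum_cons', Finset.sum_comm]
  refine Finset.sum_le_sum fun v _ => ?_
  refine (Gf_super _ fun b j => yPath_nonneg P hP0 g _ _ hμ0 _).trans (le_of_eq ?_)
  congr 1
  ext j
  simp only [← Fin.cons_snoc_eq_snoc_cons]
  exact yPath_cons_sum P μ hμ1 hμ2 g _ _

theorem lumpCost_eq (P : Matrix 𝒳 𝒳 ℝ) (μ : 𝒳 → ℝ) (g : 𝒳 → 𝒴) (k : ℕ) :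
    lumpCost μ P g k = aSeq μ P g (k + 1) - cSeq μ P g k := by
  unfold lumpCost cSeq aSeq
  rw [condEnt_eq, condEnt_eq]
  congr 1
  rw [Fintype.sum_prod_type]
  refine Finset.sum_congr rfl fun x _ => ?_
  rw [Finset.mul_sum]
  simp only [xyPath_eq, Gf_smul]

theorem yPath_last (P : Matrix 𝒳 𝒳 ℝ) (μ : 𝒳 → ℝ) (hμ1 : ∑ x : 𝒳, μ x = 1)
    (hμ2 : ∀ j, ∑ i : 𝒳, μ i * P i j = μ j) (g : 𝒳 → 𝒴) (n : ℕ) (j : 𝒴) :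
    ∑ v : Fin n → 𝒴, yPath μ P g (n + 1) (Fin.snoc v j) = ∑ a, if g a = j then μ a else 0 := by
  induction n with
  | zero =>
    have : ∀ y : Fin 0 → 𝒴, (Fin.snoc y j : Fin 1 → 𝒴) = Fin.cons j y := by
      intro y; ext i; fin_cases i; simp [Fin.snoc]
    simp only [this, yPath_cons, yPath_zero, mul_one]
    simp
  | succ n ih =>
    rw [sum_cons', Finset.sum_comm, ← ih]
    refine Finset.sum_congr rfl fun v _ => ?_
    simp only [← Fin.cons_snoc_eq_snoc_cons]
    exact yPath_cons_sum P μ hμ1 hμ2 g _ _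

/-- Entropy of a law minus the entropy of its image. -/
noncomputable def Kf (g : 𝒳 → 𝒴) (ν : 𝒳 → ℝ) : ℝ :=
  ∑ b, Gf (fun a => if g a = b then ν a else 0)

theorem Kf_eq (g : 𝒳 → 𝒴) (ν : 𝒳 → ℝ) :
    Kf g ν = ∑ a, Real.negMulLog (ν a) - ∑ b, Real.negMulLog (∑ a, if g a = b then ν a else 0) := by
  unfold Kf Gf
  rw [Finset.sum_sub_distrib, ← sum_fib g]
  congr 1
  refine Finset.sum_congr rfl fun b _ => Finset.sum_congr rfl fun a _ => ?_
  by_cases h : g a = b <;> simp [h]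

theorem Kf_super (P : Matrix 𝒳 𝒳 ℝ) (hP0 : ∀ i j, 0 ≤ P i j)
    (μ : 𝒳 → ℝ) (hμ0 : ∀ x, 0 ≤ μ x)
    (hμ2 : ∀ j, ∑ i : 𝒳, μ i * P i j = μ j) (g : 𝒳 → 𝒴) :
    ∑ x, μ x * Kf g (P x) ≤ Kf g μ := by
  unfold Kf
  simp only [Finset.mul_sum]
  rw [Finset.sum_comm]
  refine Finset.sum_le_sum fun b _ => ?_
  refine (Gf_super_w _ _ hμ0 ?_).trans (le_of_eq ?_)
  · intro i a; split_ifs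
    · exact hP0 _ _
    · exact le_rfl
  · congr 1
    ext a
    split_ifs
    · exact hμ2 a
    · simp

theorem aSeq_zero (P : Matrix 𝒳 𝒳 ℝ) (g : 𝒳 → 𝒴) (π : 𝒳 → ℝ) (hπ : ∑ x, π x = 1) :
    aSeq π P g 0 = ∑ b, Real.negMulLog (∑ a, if g a = b then π a else 0) := by
  have : ∀ (y : Fin 0 → 𝒴) (j : 𝒴), (Fin.snoc y j : Fin 1 → 𝒴) = Fin.cons j y := by
    intro y j; ext i; fin_cases i; simp [Fin.snoc]
  simp only [aSeq, this, yPath_cons, yPath_zero, mul_one]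
  simp [Gf, sum_fib, hπ]

theorem part1 (P : Matrix 𝒳 𝒳 ℝ) (hP0 : ∀ i j, 0 ≤ P i j) (hP1 : ∀ i, ∑ j : 𝒳, P i j = 1)
    (μ : 𝒳 → ℝ) (hμ0 : ∀ x, 0 ≤ μ x) (hμ1 : ∑ x : 𝒳, μ x = 1)
    (hμ2 : ∀ j, ∑ i : 𝒳, μ i * P i j = μ j) (g : 𝒳 → 𝒴) (k : ℕ) :
    lumpCost μ P g k ≤ predCost μ P g k := by
  have hX : mutInfPMF (fun q : 𝒳 × 𝒳 => μ q.1 * P q.1 q.2) =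
      ∑ a, Real.negMulLog (μ a) - ∑ a, μ a * ∑ c, Real.negMulLog (P a c) := by
    unfold mutInfPMF entPMF margFst margSnd
    simp only [← Finset.mul_sum, hP1, mul_one, hμ2]
    rw [Fintype.sum_prod_type]
    simp only [Real.negMulLog_mul, Finset.sum_add_distrib, ← Finset.mul_sum, ← Finset.sum_mul, hP1]
    ring
  have hY : mutInfPMF (fun q : 𝒴 × (Fin (k + 1) → 𝒴) => yPath μ P g (k + 2) (Fin.snoc q.2 q.1)) =
      (∑ b, Real.negMulLog (∑ a, if g a = b then μ a else 0)) - aSeq μ P g (k + 1) := by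
    have h := condEnt_eq
      (fun q : 𝒴 × (Fin (k + 1) → 𝒴) => yPath μ P g (k + 2) (Fin.snoc q.2 q.1))
    unfold condEntPMF at h
    have h2 : entPMF (margFst (fun q : 𝒴 × (Fin (k + 1) → 𝒴) =>
        yPath μ P g (k + 2) (Fin.snoc q.2 q.1))) =
        ∑ b, Real.negMulLog (∑ a, if g a = b then μ a else 0) := by
      unfold entPMF margFst
      refine Finset.sum_congr rfl fun b _ => ?_
      rw [← yPath_last P μ hμ1 hμ2 g (k + 1) b]
    unfold mutInfPMF
    rw [h2]
    unfold aSeq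
    linarith
  rw [lumpCost_eq, predCost, hX, hY]
  have h0 := cSeq_mono P hP0 μ hμ0 hμ2 g (Nat.zero_le k)
  have h1 : cSeq μ P g 0 = ∑ a, μ a * ∑ c, Real.negMulLog (P a c) - ∑ a, μ a * Kf g (P a) := by
    unfold cSeq
    rw [← Finset.sum_sub_distrib]
    refine Finset.sum_congr rfl fun a _ => ?_
    rw [aSeq_zero P g _ (hP1 a), Kf_eq]
    ring
  have h2 := Kf_super P hP0 μ hμ0 hμ2 g
  rw [Kf_eq g μ] at h2
  linarith

end Helpers

section Helpers2

set_option linter.unusedSectionVars false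

variable {𝒳 : Type*} {𝒴 : Type*} [Fintype 𝒳] [DecidableEq 𝒳] [Fintype 𝒴] [DecidableEq 𝒴]

/-- The last `K` entries. -/
def suf {𝒴 : Type*} (K n : ℕ) (h : K ≤ n) (y : Fin n → 𝒴) : Fin K → 𝒴 :=
  fun i => y ⟨n - K + i.val, by have := i.isLt; omega⟩

theorem suf_self {𝒴 : Type*} (K : ℕ) (y : Fin K → 𝒴) : suf K K le_rfl y = y := by
  funext i
  unfold suf
  congr 1
  ext
  simp

theorem suf_cons {𝒴 : Type*} (K n : ℕ) (h : K ≤ n) (a : 𝒴) (y : Fin n → 𝒴) :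
    suf K (n + 1) (h.trans n.le_succ) (Fin.cons a y : Fin (n + 1) → 𝒴) = suf K n h y := by
  funext i
  unfold suf
  have : (⟨n + 1 - K + i.val, by have := i.isLt; omega⟩ : Fin (n + 1)) =
      Fin.succ ⟨n - K + i.val, by have := i.isLt; omega⟩ := by
    ext; simp; omega
  rw [this, Fin.cons_succ]

theorem suf_snoc {𝒴 : Type*} (K n : ℕ) (h : K ≤ n) (a : 𝒴) (y : Fin n → 𝒴) :
    suf (K + 1) (n + 1) (Nat.succ_le_succ h) (Fin.snoc y a : Fin (n + 1) → 𝒴) =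
      Fin.snoc (suf K n h y) a := by
  funext i
  induction i using Fin.lastCases with
  | last =>
    unfold suf
    have : (⟨n + 1 - (K + 1) + (Fin.last K).val, by have := (Fin.last K).isLt; omega⟩ :
        Fin (n + 1)) = Fin.last n := by
      ext; simp; omega
    rw [this, Fin.snoc_last, Fin.snoc_last]
  | cast i =>
    rw [Fin.snoc_castSucc]
    unfold suf
    have : (⟨n + 1 - (K + 1) + i.castSucc.val, by have := i.isLt; simp; omega⟩ :
        Fin (n + 1)) = Fin.castSucc ⟨n - K + i.val, by have := i.isLt; omega⟩ := by
      ext; simp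
    rw [this, Fin.snoc_castSucc]

theorem suf_sum (P : Matrix 𝒳 𝒳 ℝ) (μ : 𝒳 → ℝ) (hμ1 : ∑ x : 𝒳, μ x = 1)
    (hμ2 : ∀ j, ∑ i : 𝒳, μ i * P i j = μ j) (g : 𝒳 → 𝒴) (K : ℕ) (F : (Fin K → 𝒴) → ℝ)
    (n : ℕ) (h : K ≤ n) :
    ∑ y : Fin n → 𝒴, yPath μ P g n y * F (suf K n h y) = ∑ v, yPath μ P g K v * F v := by
  induction n, h using Nat.le_induction with
  | base => simp only [suf_self]
  | succ n h ih =>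
    rw [sum_cons', Finset.sum_comm, ← ih]
    refine Finset.sum_congr rfl fun y _ => ?_
    simp only [suf_cons K n h]
    rw [← Finset.sum_mul, yPath_cons_sum P μ hμ1 hμ2]

theorem suf_le (P : Matrix 𝒳 𝒳 ℝ) (hP0 : ∀ i j, 0 ≤ P i j)
    (μ : 𝒳 → ℝ) (hμ0 : ∀ x, 0 ≤ μ x) (hμ1 : ∑ x : 𝒳, μ x = 1)
    (hμ2 : ∀ j, ∑ i : 𝒳, μ i * P i j = μ j) (g : 𝒳 → 𝒴) (K : ℕ)
    (n : ℕ) (h : K ≤ n) (y : Fin n → 𝒴) :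
    yPath μ P g n y ≤ yPath μ P g K (suf K n h y) := by
  induction n, h using Nat.le_induction with
  | base => simp only [suf_self, le_rfl]
  | succ n h ih =>
    induction y using Fin.consCases with
    | _ b y =>
    rw [suf_cons K n h]
    refine le_trans ?_ (ih y)
    rw [← yPath_cons_sum P μ hμ1 hμ2 g n y]
    exact Finset.single_le_sum (f := fun b => yPath μ P g (n + 1) (Fin.cons b y))
      (fun b _ => yPath_nonneg P hP0 g _ _ hμ0 _) (Finset.mem_univ b)

theorem snoc_le (P : Matrix 𝒳 𝒳 ℝ) (hP0 : ∀ i j, 0 ≤ P i j) (hP1 : ∀ i, ∑ j : 𝒳, P i j = 1)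
    (μ : 𝒳 → ℝ) (hμ0 : ∀ x, 0 ≤ μ x) (hμ1 : ∑ x : 𝒳, μ x = 1)
    (g : 𝒳 → 𝒴) (n : ℕ) (y : Fin n → 𝒴) (j : 𝒴) :
    yPath μ P g (n + 1) (Fin.snoc y j) ≤ yPath μ P g n y := by
  rw [← yPath_snoc_sum P hP1 g n μ hμ1 y]
  exact Finset.single_le_sum (f := fun b => yPath μ P g (n + 1) (Fin.snoc y b))
      (fun b _ => yPath_nonneg P hP0 g _ _ hμ0 _) (Finset.mem_univ j)

theorem mkv_base {K : ℕ} (ρ : (Fin K → 𝒴) → ℝ) (R : (Fin K → 𝒴) → 𝒴 → ℝ) (y : Fin K → 𝒴) :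
    mkvPath ρ R K y = ρ y := by
  unfold mkvPath
  rw [dif_pos le_rfl, Finset.prod_eq_one, mul_one]
  intro m _
  rw [dif_neg (by have := m.isLt; omega)]

theorem mkv_snoc {K : ℕ} (ρ : (Fin K → 𝒴) → ℝ) (R : (Fin K → 𝒴) → 𝒴 → ℝ) (n : ℕ) (h : K ≤ n)
    (y : Fin n → 𝒴) (j : 𝒴) :
    mkvPath ρ R (n + 1) (Fin.snoc y j) = mkvPath ρ R n y * R (suf K n h y) j := by
  have hs : ∀ (i : ℕ) (hi : i < n) (hi' : i < n + 1),
      (Fin.snoc y j : Fin (n + 1) → 𝒴) ⟨i, hi'⟩ = y ⟨i, hi⟩ := by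
    intro i hi hi'
    exact Fin.snoc_castSucc (α := fun _ => 𝒴) j y ⟨i, hi⟩
  unfold mkvPath
  rw [dif_pos h, dif_pos (h.trans n.le_succ), Fin.prod_univ_castSucc, ← mul_assoc]
  congr 1
  · congr 1
    · congr 1
      funext i
      exact hs _ _ _
    · refine Finset.prod_congr rfl fun m _ => ?_
      by_cases hm : K ≤ m.val
      · rw [dif_pos hm, dif_pos (by simpa using hm), Fin.snoc_castSucc]
        congr 1
        funext i
        exact hs _ _ _
      · rw [dif_neg hm, dif_neg (by simpa using hm)]
  · rw [dif_pos (by simpa using h), Fin.snoc_last]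
    congr 1
    funext i
    exact hs _ _ _

theorem part2 (P : Matrix 𝒳 𝒳 ℝ) (hP0 : ∀ i j, 0 ≤ P i j) (hP1 : ∀ i, ∑ j : 𝒳, P i j = 1)
    (μ : 𝒳 → ℝ) (hμ0 : ∀ x, 0 ≤ μ x) (hμ1 : ∑ x : 𝒳, μ x = 1)
    (hμ2 : ∀ j, ∑ i : 𝒳, μ i * P i j = μ j) (g : 𝒳 → 𝒴) (K n : ℕ) (hn : K ≤ n)
    (q : (n : ℕ) → (Fin n → 𝒴) → ℝ)
    (hq : q = mkvPath (yPath μ P g K)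
      (fun v j => yPath μ P g (K + 1) (Fin.snoc v j) / yPath μ P g K v)) :
    (∑ y : Fin (n + 1) → 𝒴, yPath μ P g (n + 1) y *
      Real.log (yPath μ P g (n + 1) y / q (n + 1) y)) -
    (∑ y : Fin n → 𝒴, yPath μ P g n y * Real.log (yPath μ P g n y / q n y)) =
    aSeq μ P g K - aSeq μ P g n := by
  have p0 : ∀ n (y : Fin n → 𝒴), 0 ≤ yPath μ P g n y := fun n y =>
    yPath_nonneg P hP0 g _ _ hμ0 _
  have qs : ∀ n (h : K ≤ n) (y : Fin n → 𝒴) j, q (n + 1) (Fin.snoc y j) =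
      q n y * (yPath μ P g (K + 1) (Fin.snoc (suf K n h y) j) / yPath μ P g K (suf K n h y)) := by
    intro n h y j
    rw [hq, mkv_snoc _ _ n h]
  have posR : ∀ n (h : K ≤ n) (y : Fin n → 𝒴) j, 0 < yPath μ P g (n + 1) (Fin.snoc y j) →
      0 < yPath μ P g n y ∧ 0 < yPath μ P g (K + 1) (Fin.snoc (suf K n h y) j) ∧
      0 < yPath μ P g K (suf K n h y) := by
    intro n h y j hp
    have h1 := snoc_le P hP0 hP1 μ hμ0 hμ1 g n y j
    have h2 := suf_le P hP0 μ hμ0 hμ1 hμ2 g (K + 1) (n + 1) (Nat.succ_le_succ h) (Fin.snoc y j)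
    rw [suf_snoc K n h] at h2
    have h3 := snoc_le P hP0 hP1 μ hμ0 hμ1 g K (suf K n h y) j
    exact ⟨by linarith, by linarith, by linarith⟩
  have posq : ∀ n (_ : K ≤ n) (y : Fin n → 𝒴), 0 < yPath μ P g n y → 0 < q n y := by
    intro n h
    induction n, h using Nat.le_induction with
    | base => intro y hy; rw [hq, mkv_base]; exact hy
    | succ n h ih =>
      intro y hy
      induction y using Fin.snocCases with
      | _ y j =>
      obtain ⟨h1, h2, h3⟩ := posR n h y j hy
      rw [qs n h]
      exact mul_pos (ih y h1) (div_pos h2 h3)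
  -- term-wise expansion
  have e1 : ∀ (y : Fin n → 𝒴) j, yPath μ P g (n + 1) (Fin.snoc y j) *
      Real.log (yPath μ P g (n + 1) (Fin.snoc y j) / q (n + 1) (Fin.snoc y j)) =
      yPath μ P g (n + 1) (Fin.snoc y j) * Real.log (yPath μ P g n y / q n y)
      - yPath μ P g (n + 1) (Fin.snoc y j) *
        (Real.log (yPath μ P g n y) - Real.log (yPath μ P g (n + 1) (Fin.snoc y j)))
      + yPath μ P g (n + 1) (Fin.snoc y j) *
        (Real.log (yPath μ P g K (suf K n hn y)) -
          Real.log (yPath μ P g (K + 1) (Fin.snoc (suf K n hn y) j))) := by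
    intro y j
    rcases (p0 _ (Fin.snoc y j)).eq_or_lt with h | h
    · rw [← h]; simp
    · obtain ⟨h1, h2, h3⟩ := posR n hn y j h
      have h4 := posq n hn y h1
      rw [qs n hn, Real.log_div h.ne' (mul_pos h4 (div_pos h2 h3)).ne',
        Real.log_mul h4.ne' (div_pos h2 h3).ne', Real.log_div h2.ne' h3.ne',
        Real.log_div h1.ne' h4.ne']
      ring
  have aS : ∀ n, aSeq μ P g n = ∑ y : Fin n → 𝒴, ∑ j, yPath μ P g (n + 1) (Fin.snoc y j) *
        (Real.log (yPath μ P g n y) - Real.log (yPath μ P g (n + 1) (Fin.snoc y j))) := by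
    intro n
    unfold aSeq
    refine Finset.sum_congr rfl fun y _ => ?_
    rw [Gf_eq, yPath_snoc_sum P hP1 g n μ hμ1]
  have hsuf := suf_sum P μ hμ1 hμ2 g (K + 1) (fun v =>
    Real.log (yPath μ P g K (Fin.init v)) - Real.log (yPath μ P g (K + 1) v)) (n + 1)
    (Nat.succ_le_succ hn)
  rw [sum_snoc', sum_snoc'] at hsuf
  simp only [suf_snoc K n hn, Fin.init_snoc] at hsuf
  rw [← aS] at hsuf
  rw [sum_snoc']
  simp only [e1, Finset.sum_add_distrib, Finset.sum_sub_distrib]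
  simp only [mul_sub, Finset.sum_sub_distrib] at hsuf aS ⊢
  rw [aS n]
  simp only [← Finset.sum_mul, yPath_snoc_sum P hP1 g n μ hμ1] at hsuf ⊢
  linarith

theorem part2' (P : Matrix 𝒳 𝒳 ℝ) (hP0 : ∀ i j, 0 ≤ P i j) (hP1 : ∀ i, ∑ j : 𝒳, P i j = 1)
    (μ : 𝒳 → ℝ) (hμ0 : ∀ x, 0 ≤ μ x) (hμ1 : ∑ x : 𝒳, μ x = 1)
    (hμ2 : ∀ j, ∑ i : 𝒳, μ i * P i j = μ j) (g : 𝒳 → 𝒴) (k : ℕ) :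
    ∃ d : ℝ,
      Tendsto (fun n : ℕ => (n : ℝ)⁻¹ *
          ∑ y : Fin n → 𝒴, yPath μ P g n y *
            Real.log (yPath μ P g n y /
              mkvPath (yPath μ P g (k + 1))
                (fun v j => yPath μ P g (k + 2) (Fin.snoc v j) / yPath μ P g (k + 1) v) n y))
        atTop (nhds d) ∧
      d ≤ lumpCost μ P g k := by
  have hb : ∀ n, k ≤ n → cSeq μ P g k ≤ aSeq μ P g (n + 1) := fun n hn =>
    (cSeq_mono P hP0 μ hμ0 hμ2 g hn).trans (aSeq_step P hP0 g n μ hμ0)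
  have anti := aSeq_anti P hP0 μ hμ0 hμ1 hμ2 g
  have hb' : ∀ n, cSeq μ P g k ≤ aSeq μ P g n := fun n =>
    (hb (max n k) (le_max_right _ _)).trans (anti ((le_max_left n k).trans (Nat.le_succ _)))
  have hlim := tendsto_atTop_ciInf anti ⟨cSeq μ P g k, by rintro _ ⟨n, rfl⟩; exact hb' n⟩
  have hL : cSeq μ P g k ≤ ⨅ n, aSeq μ P g n := le_ciInf hb'
  set L := ⨅ n, aSeq μ P g n
  refine ⟨aSeq μ P g (k + 1) - L, ?_, by rw [lumpCost_eq]; linarith⟩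
  set D : ℕ → ℝ := fun n => ∑ y : Fin n → 𝒴, yPath μ P g n y *
            Real.log (yPath μ P g n y /
              mkvPath (yPath μ P g (k + 1))
                (fun v j => yPath μ P g (k + 2) (Fin.snoc v j) / yPath μ P g (k + 1) v) n y) with hD
  have hinc : Tendsto (fun n => D (n + 1) - D n) atTop (nhds (aSeq μ P g (k + 1) - L)) := by
    refine (tendsto_const_nhds.sub hlim).congr' ?_
    filter_upwards [eventually_ge_atTop (k + 1)] with n hn
    exact (part2 P hP0 hP1 μ hμ0 hμ1 hμ2 g (k + 1) n hn _ rfl).symm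
  have hc := hinc.cesaro
  have h0 : Tendsto (fun n : ℕ => (n : ℝ)⁻¹ * D 0) atTop (nhds 0) := by
    simpa using (tendsto_inv_atTop_nhds_zero_nat (𝕜 := ℝ)).mul_const (D 0)
  have := hc.add h0
  rw [add_zero] at this
  refine this.congr fun n => ?_
  rw [Finset.sum_range_sub, ← mul_add, sub_add_cancel]

end Helpers2

/-- for every order k+1 ≥ 1,
Δ_P^{k+1}(X, g) ≥ Δ_L^{k+1}(X, g) ≥ D̄(Y ‖ Y^{(k+1)}), where Y^{(k+1)} is the stationary
(k+1)-th order Markov chain on 𝒴 with transition matrix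
Q_{i_1..i_{k+1}→j} = p_{Y_{k+2}|Y_1^{k+1}}(j | i_1..i_{k+1}); in particular the KL divergence
rate D̄(Y ‖ Y^{(k+1)}) exists. -/
theorem stmt12 {𝒳 𝒴 : Type*} [Fintype 𝒳] [DecidableEq 𝒳] [Fintype 𝒴] [DecidableEq 𝒴]
    (P : Matrix 𝒳 𝒳 ℝ) (hP0 : ∀ i j, 0 ≤ P i j) (hP1 : ∀ i, ∑ j : 𝒳, P i j = 1)
    (hprim : PrimitiveMatrix P)
    (μ : 𝒳 → ℝ) (hμ0 : ∀ x, 0 ≤ μ x) (hμ1 : ∑ x : 𝒳, μ x = 1)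
    (hμ2 : ∀ j, ∑ i : 𝒳, μ i * P i j = μ j) (g : 𝒳 → 𝒴) (k : ℕ) :
    lumpCost μ P g k ≤ predCost μ P g k ∧
    ∃ d : ℝ,
      Tendsto (fun n : ℕ => (n : ℝ)⁻¹ *
          ∑ y : Fin n → 𝒴, yPath μ P g n y *
            Real.log (yPath μ P g n y /
              mkvPath (yPath μ P g (k + 1))
                (fun v j => yPath μ P g (k + 2) (Fin.snoc v j) / yPath μ P g (k + 1) v) n y))
        atTop (nhds d) ∧
      d ≤ lumpCost μ P g k := by
  exact ⟨part1 P hP0 hP1 μ hμ0 hμ1 hμ2 g k, part2' P hP0 hP1 μ hμ0 hμ1 hμ2 g k⟩
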